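/- arXiv:math/9910156 — 2 statements merged into one kernel-verified Lean document; each statement's English description precedes it below -/
import Mathlib

section
/- Let α ∈ ℂ with −1 ≤ Re(α) < 0 and p ∈ ℕ. For every smooth compactly supported function φ : ℂ → ℂ one has ∫_ℂ u_{α,p}(t)·(α·φ(t) − t·(∂_tφ)(t)) dA(t) = ∫_ℂ u_{α,p−1}(t)·φ(t) dA(t), and likewise ∫_ℂ u_{α,p}(t)·(α·φ(t) − t̄·(∂_{t̄}φ)(t)) dA(t) = ∫_ℂ u_{α,p−1}(t)·φ(t) dA(t), where u_{α,−1} = 0. (This is the distributional identity (∂_t t + α)u_{α,p} = (∂_{t̄} t̄ + α)u_{α,p} = u_{α,p−1}.) -/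
open MeasureTheory

/-- The basic regular holonomic distribution `u_{α,p}(t) = |t|^{-2(α+1)} (log|t|²)^p / p!`,
set to `0` at `t = 0`. -/
noncomputable def uap (α : ℂ) (p : ℕ) (t : ℂ) : ℂ :=
  if t = 0 then 0
  else ((‖t‖ ^ 2 : ℝ) : ℂ) ^ (-(α + 1)) * ((Real.log (‖t‖ ^ 2) : ℝ) : ℂ) ^ p /
    (p.factorial : ℂ)

/-- The Wirtinger derivative `∂_t φ = (1/2)(D_x φ - i D_y φ)`. -/
noncomputable def wirtD (φ : ℂ → ℂ) (z : ℂ) : ℂ :=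
  (1 / 2) * (lineDeriv ℝ φ z 1 - Complex.I * lineDeriv ℝ φ z Complex.I)

/-- The anti-Wirtinger derivative `∂_{t̄} φ = (1/2)(D_x φ + i D_y φ)`. -/
noncomputable def wirtDbar (φ : ℂ → ℂ) (z : ℂ) : ℂ :=
  (1 / 2) * (lineDeriv ℝ φ z 1 + Complex.I * lineDeriv ℝ φ z Complex.I)

open Set Filter Topology

/-- The radial profile of `uap`, as a function of `s = |t|²`. -/
noncomputable def logPow (α : ℂ) (p : ℕ) (s : ℝ) : ℂ :=
  (s : ℂ) ^ (-(α + 1)) * ((Real.log s : ℝ) : ℂ) ^ p / (p.factorial : ℂ)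

/-- The profile with index `p - 1`, with value `0` when `p = 0`. -/
noncomputable def logPowPred (α : ℂ) (p : ℕ) (s : ℝ) : ℂ :=
  if p = 0 then 0 else logPow α (p - 1) s

theorem uap_eq_logPow (α : ℂ) (p : ℕ) {t : ℂ} (ht : t ≠ 0) :
    uap α p t = logPow α p (Complex.normSq t) := by
  simp [uap, logPow, ht, Complex.normSq_eq_norm_sq]

theorem hasDerivAt_logPow (α : ℂ) (p : ℕ) {s : ℝ} (hs : 0 < s) :
    HasDerivAt (logPow α p) ((-(α + 1) * logPow α p s + logPowPred α p s) / s) s := by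
  have hs' : (s : ℂ) ≠ 0 := by exact_mod_cast hs.ne'
  have h1 : HasDerivAt (fun y : ℝ => (y : ℂ) ^ (-(α + 1)))
      (-(α + 1) * (s : ℂ) ^ (-(α + 1) - 1)) s := by
    by_cases h : -(α + 1) = 0
    · simpa [h] using hasDerivAt_const s (1 : ℂ)
    · exact hasDerivAt_ofReal_cpow_const hs.ne' h
  have h2 : HasDerivAt (fun y : ℝ => ((Real.log y : ℝ) : ℂ)) ((s⁻¹ : ℝ) : ℂ) s :=
    (Real.hasDerivAt_log hs.ne').ofReal_comp
  refine ((h1.mul (h2.pow p)).div_const (p.factorial : ℂ)).congr_deriv ?_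
  rw [Complex.cpow_sub _ _ hs', Complex.cpow_one]
  rcases p with _ | p
  · simp [logPowPred, logPow]
    ring
  · have hp : (p.factorial : ℂ) ≠ 0 := by exact_mod_cast p.factorial_ne_zero
    have hp' : (p : ℂ) + 1 ≠ 0 := by exact_mod_cast p.succ_ne_zero
    simp only [logPowPred, logPow, Nat.factorial_succ, Pi.pow_apply]
    push_cast
    simp
    field_simp

theorem continuousOn_logPow (α : ℂ) (p : ℕ) : ContinuousOn (logPow α p) (Ioi 0) :=
  fun _ hs => (hasDerivAt_logPow α p hs).continuousAt.continuousWithinAt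

theorem continuousOn_logPowPred (α : ℂ) (p : ℕ) : ContinuousOn (logPowPred α p) (Ioi 0) := by
  unfold logPowPred
  split_ifs
  · exact continuousOn_const
  · exact continuousOn_logPow α _

theorem exists_abs_log_le_rpow {d : ℝ} (hd : 0 < d) (M : ℝ) :
    ∃ C, 0 ≤ C ∧ ∀ s, 0 < s → s ≤ M → |Real.log s| ≤ C * s ^ (-d) := by
  refine ⟨1 / d + |Real.log M| * |M| ^ d, by positivity, fun s hs hsM => ?_⟩
  rw [Real.rpow_neg hs.le, ← div_eq_mul_inv, le_div_iff₀ (by positivity)]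
  rcases le_total s 1 with h | h
  · have := Real.abs_log_mul_self_rpow_lt s d hs h hd
    rw [abs_mul, abs_of_pos (Real.rpow_pos_of_pos hs d)] at this
    have : 0 ≤ |Real.log M| * |M| ^ d := by positivity
    linarith
  · have h1 : |Real.log s| ≤ |Real.log M| := by
      rw [abs_of_nonneg (Real.log_nonneg h), abs_of_nonneg (Real.log_nonneg (h.trans hsM))]
      exact Real.log_le_log hs hsM
    have h2 : s ^ d ≤ |M| ^ d := Real.rpow_le_rpow hs.le (hsM.trans (le_abs_self M)) hd.le
    have : 0 < 1 / d := by positivity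
    nlinarith [mul_le_mul h1 h2 (by positivity) (by positivity)]

theorem exists_norm_logPow_le (α : ℂ) (p : ℕ) {β : ℝ} (hβ : α.re + 1 < β) (M : ℝ) :
    ∃ C, 0 ≤ C ∧ ∀ s, 0 < s → s ≤ M → ‖logPow α p s‖ ≤ C * s ^ (-β) := by
  have hd : 0 < β - (α.re + 1) := by linarith
  obtain ⟨C, hC, h⟩ := exists_abs_log_le_rpow (d := (β - (α.re + 1)) / (p + 1)) (by positivity) M
  obtain ⟨C', hC', h'⟩ : ∃ C', 0 ≤ C' ∧ ∀ s, 0 < s → s ≤ M →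
      1 ≤ C' * s ^ (-((β - (α.re + 1)) / (p + 1))) := by
    refine ⟨|M| ^ ((β - (α.re + 1)) / (p + 1)), by positivity, fun s hs hsM => ?_⟩
    rw [Real.rpow_neg hs.le, ← div_eq_mul_inv, one_le_div (by positivity)]
    exact Real.rpow_le_rpow hs.le (hsM.trans (le_abs_self M)) (by positivity)
  refine ⟨C ^ p * C', by positivity, fun s hs hsM => ?_⟩
  have e : s ^ (-β) = s ^ (-(α.re + 1)) *
      ((s ^ (-((β - (α.re + 1)) / (p + 1)))) ^ p * s ^ (-((β - (α.re + 1)) / (p + 1)))) := by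
    rw [← pow_succ, ← Real.rpow_natCast, ← Real.rpow_mul hs.le, ← Real.rpow_add hs]
    congr 1
    push_cast
    field_simp
    ring
  have hfac : (1 : ℝ) ≤ p.factorial := by exact_mod_cast p.factorial_pos
  have hnorm : ‖logPow α p s‖ ≤ s ^ (-(α.re + 1)) * |Real.log s| ^ p := by
    rw [logPow, norm_div, norm_mul, norm_pow, Complex.norm_cpow_eq_rpow_re_of_pos hs]
    simp only [Complex.norm_real, Real.norm_eq_abs, Complex.norm_natCast]
    simpa using div_le_self (by positivity) hfac
  rw [e]
  have h3 := pow_le_pow_left₀ (abs_nonneg _) (h s hs hsM) p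
  rw [mul_pow] at h3
  have h4 := mul_le_mul h3 (h' s hs hsM) zero_le_one (by positivity)
  have h5 := mul_le_mul_of_nonneg_left h4 (Real.rpow_nonneg hs.le (-(α.re + 1)))
  rw [mul_one] at h5
  refine hnorm.trans (h5.trans (le_of_eq ?_))
  ring

theorem exists_norm_logPowPred_le (α : ℂ) (p : ℕ) {β : ℝ} (hβ : α.re + 1 < β) (M : ℝ) :
    ∃ C, 0 ≤ C ∧ ∀ s, 0 < s → s ≤ M → ‖logPowPred α p s‖ ≤ C * s ^ (-β) := by
  by_cases hp : p = 0
  · exact ⟨0, le_rfl, fun s _ _ => by simp [logPowPred, hp]⟩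
  · simpa [logPowPred, hp] using exists_norm_logPow_le α (p - 1) hβ M

theorem locallyIntegrable_normSq_rpow {β : ℝ} (hβ : β < 1) :
    LocallyIntegrable (fun t : ℂ => Complex.normSq t ^ (-β)) := by
  have key (R : ℝ) (hR : 0 < R) :
      IntegrableOn (fun t : ℂ => Complex.normSq t ^ (-β)) (Metric.ball 0 R) := by
    simp only [Complex.normSq_eq_norm_sq]
    rw [integrableOn_fun_norm_addHaar (f := fun y : ℝ => (y ^ 2) ^ (-β)) volume]
    refine ((intervalIntegral.integrableOn_Ioo_rpow_iff (s := 1 - 2 * β) hR).2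
      (by linarith)).congr_fun (fun y hy => ?_) measurableSet_Ioo
    simp only [Complex.finrank_real_complex, smul_eq_mul]
    rw [← Real.rpow_natCast y 2, ← Real.rpow_mul hy.1.le, ← Real.rpow_natCast,
      ← Real.rpow_add hy.1]
    congr 1
    push_cast
    ring
  intro x
  refine ⟨Metric.ball 0 (‖x‖ + 1), Metric.isOpen_ball.mem_nhds ?_, key _ (by positivity)⟩
  simp

theorem integral_eq_zero_of_hasLineDerivAt {f f' : ℂ → ℂ} {v : ℂ}
    (hf : Continuous f) (hfc : HasCompactSupport f)
    (hf' : Continuous f') (hfc' : HasCompactSupport f')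
    (h : ∀ x, HasLineDerivAt ℝ f (f' x) x v) : ∫ x, f' x = 0 := by
  have := integral_bilinear_hasLineDerivAt_right_eq_neg_left_of_integrable (μ := volume)
    (f := fun _ : ℂ => (1 : ℂ)) (f' := fun _ => 0) (g := f) (g' := f') (v := v)
    (B := ContinuousLinearMap.mul ℝ ℂ) (by simp)
    (by simpa using hf'.integrable_of_hasCompactSupport hfc')
    (by simpa using hf.integrable_of_hasCompactSupport hfc)
    (fun x _ => hasDerivAt_const (0 : ℝ) (1 : ℂ))
    (fun x _ => h x)
  simpa using this

/-- The Wirtinger-type operator `(1/2)(D_x + c D_y)`; it is `∂_t` for `c = -i` and `∂_{t̄}` for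
`c = i`. -/
noncomputable def wirt (c : ℂ) (φ : ℂ → ℂ) (z : ℂ) : ℂ :=
  (1 / 2) * (lineDeriv ℝ φ z 1 + c * lineDeriv ℝ φ z Complex.I)

/-- The linear form `x - c y`; it is `t` for `c = -i` and `t̄` for `c = i`. -/
noncomputable def wirtCoord (c t : ℂ) : ℂ := t.re - c * t.im

theorem continuous_wirtCoord (c : ℂ) : Continuous (wirtCoord c) := by
  unfold wirtCoord
  fun_prop

theorem hasLineDerivAt_wirtCoord (c x v : ℂ) :
    HasLineDerivAt ℝ (wirtCoord c) (wirtCoord c v) x v := by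
  have h1 : HasDerivAt (fun τ : ℝ => (τ : ℂ)) 1 0 := (hasDerivAt_id (0 : ℝ)).ofReal_comp
  have := (h1.mul_const (wirtCoord c v)).const_add (wirtCoord c x)
  rw [one_mul] at this
  refine this.congr_of_eventuallyEq (Eventually.of_forall fun τ => ?_)
  simp [wirtCoord]
  ring

theorem hasDerivAt_normSq_line (x v : ℂ) (ε : ℝ) :
    HasDerivAt (fun τ : ℝ => Complex.normSq (x + τ • v) + ε)
      (2 * (x.re * v.re + x.im * v.im)) 0 := by
  have hl (a b : ℝ) : HasDerivAt (fun τ : ℝ => (a + τ * b) * (a + τ * b)) (2 * (a * b)) 0 := by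
    have h := ((hasDerivAt_id (0 : ℝ)).mul_const b).const_add a
    refine (h.mul h).congr_deriv ?_
    simp
    ring
  refine (((hl x.re v.re).add (hl x.im v.im)).add_const ε).congr_deriv (by ring)
    |>.congr_of_eventuallyEq (Eventually.of_forall fun τ => ?_)
  simp [Complex.normSq_apply]

section TestFunction

variable {φ : ℂ → ℂ}

theorem continuous_lineDeriv_of_contDiff (hφ : ContDiff ℝ (⊤ : ℕ∞) φ) (v : ℂ) :
    Continuous fun t => lineDeriv ℝ φ t v := by
  have h : (fun t => lineDeriv ℝ φ t v) = fun t => fderiv ℝ φ t v :=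
    funext fun t => (hφ.differentiable (by simp) t).lineDeriv_eq_fderiv
  rw [h]
  exact (hφ.continuous_fderiv (by simp)).clm_apply continuous_const

theorem hasCompactSupport_lineDeriv (hφ : ContDiff ℝ (⊤ : ℕ∞) φ) (hφc : HasCompactSupport φ)
    (v : ℂ) : HasCompactSupport fun t => lineDeriv ℝ φ t v := by
  have h : (fun t => lineDeriv ℝ φ t v) = fun t => fderiv ℝ φ t v :=
    funext fun t => (hφ.differentiable (by simp) t).lineDeriv_eq_fderiv
  rw [h]
  exact hφc.fderiv_apply (𝕜 := ℝ) v

theorem continuous_wirt (hφ : ContDiff ℝ (⊤ : ℕ∞) φ) (c : ℂ) : Continuous (wirt c φ) :=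
  continuous_const.mul ((continuous_lineDeriv_of_contDiff hφ 1).add
    (continuous_const.mul (continuous_lineDeriv_of_contDiff hφ Complex.I)))

theorem hasCompactSupport_wirt (hφ : ContDiff ℝ (⊤ : ℕ∞) φ) (hφc : HasCompactSupport φ) (c : ℂ) :
    HasCompactSupport (wirt c φ) :=
  ((hasCompactSupport_lineDeriv hφ hφc 1).add
    ((hasCompactSupport_lineDeriv hφ hφc Complex.I).mul_left)).mul_left

theorem continuous_comp_normSq_add {g : ℝ → ℂ} (hg : ContinuousOn g (Ioi 0)) {ε : ℝ}
    (hε : 0 < ε) : Continuous fun t : ℂ => g (Complex.normSq t + ε) :=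
  hg.comp_continuous (Complex.continuous_normSq.add continuous_const)
    fun t => add_pos_of_nonneg_of_pos (Complex.normSq_nonneg t) hε

/-- Stokes' formula for a smooth radial profile, in the direction `v`. -/
theorem integral_lineDeriv_radial_eq_zero {g g' : ℝ → ℂ} (hg : ∀ s, 0 < s → HasDerivAt g (g' s) s)
    (hg' : ContinuousOn g' (Ioi 0)) {ε : ℝ} (hε : 0 < ε) (hφ : ContDiff ℝ (⊤ : ℕ∞) φ)
    (hφc : HasCompactSupport φ) (c v : ℂ) :
    Integrable (fun t : ℂ => (wirtCoord c v * g (Complex.normSq t + ε) +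
        wirtCoord c t * (((2 * (t.re * v.re + t.im * v.im) : ℝ) : ℂ) *
          g' (Complex.normSq t + ε))) * φ t +
        wirtCoord c t * g (Complex.normSq t + ε) * lineDeriv ℝ φ t v) ∧
    ∫ t : ℂ, ((wirtCoord c v * g (Complex.normSq t + ε) +
        wirtCoord c t * (((2 * (t.re * v.re + t.im * v.im) : ℝ) : ℂ) *
          g' (Complex.normSq t + ε))) * φ t +
        wirtCoord c t * g (Complex.normSq t + ε) * lineDeriv ℝ φ t v) = 0 := by
  have hgc : Continuous fun t : ℂ => g (Complex.normSq t + ε) :=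
    continuous_comp_normSq_add (fun s hs => (hg s hs).continuousAt.continuousWithinAt) hε
  have hgc' := continuous_comp_normSq_add hg' hε
  have hW := continuous_wirtCoord c
  have hL := continuous_lineDeriv_of_contDiff hφ v
  have hφ' := hφ.continuous
  have hcont : Continuous fun t : ℂ => (wirtCoord c v * g (Complex.normSq t + ε) +
        wirtCoord c t * (((2 * (t.re * v.re + t.im * v.im) : ℝ) : ℂ) *
          g' (Complex.normSq t + ε))) * φ t +
        wirtCoord c t * g (Complex.normSq t + ε) * lineDeriv ℝ φ t v :=
    (((continuous_const.mul hgc).add (hW.mul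
      ((Complex.continuous_ofReal.comp (by fun_prop)).mul hgc'))).mul hφ').add
      ((hW.mul hgc).mul hL)
  have hsupp : HasCompactSupport fun t : ℂ => (wirtCoord c v * g (Complex.normSq t + ε) +
        wirtCoord c t * (((2 * (t.re * v.re + t.im * v.im) : ℝ) : ℂ) *
          g' (Complex.normSq t + ε))) * φ t +
        wirtCoord c t * g (Complex.normSq t + ε) * lineDeriv ℝ φ t v :=
    hφc.mul_left.add (hasCompactSupport_lineDeriv hφ hφc v).mul_left
  refine ⟨hcont.integrable_of_hasCompactSupport hsupp, ?_⟩
  refine integral_eq_zero_of_hasLineDerivAt (v := v)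
    (f := fun t => wirtCoord c t * g (Complex.normSq t + ε) * φ t) ((hW.mul hgc).mul hφ') hφc.mul_left
    hcont hsupp fun x => ?_
  have h1 := hasLineDerivAt_wirtCoord c x v
  have h2 : HasLineDerivAt ℝ φ (lineDeriv ℝ φ x v) x v :=
    (hφ.differentiable (by simp) x).lineDifferentiableAt.hasLineDerivAt
  have h3 : HasDerivAt (fun τ : ℝ => g (Complex.normSq (x + τ • v) + ε))
      (((2 * (x.re * v.re + x.im * v.im) : ℝ) : ℂ) * g' (Complex.normSq x + ε)) 0 := by
    have hx := hg _ (add_pos_of_nonneg_of_pos (Complex.normSq_nonneg x) hε)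
    have := HasDerivAt.scomp_of_eq (0 : ℝ) hx (hasDerivAt_normSq_line x v ε) (by simp)
    rw [Complex.real_smul] at this
    exact this
  unfold HasLineDerivAt at h1 h2 ⊢
  refine ((h1.mul h3).mul h2).congr_deriv ?_
  simp

theorem integral_regularized_eq_zero (α : ℂ) (p : ℕ) {c : ℂ} (hc : c ^ 2 = -1) {ε : ℝ}
    (hε : 0 < ε) (hφ : ContDiff ℝ (⊤ : ℕ∞) φ) (hφc : HasCompactSupport φ) :
    ∫ t : ℂ, (logPow α p (Complex.normSq t + ε) * (φ t + wirtCoord c t * wirt c φ t) +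
      ((Complex.normSq t / (Complex.normSq t + ε) : ℝ) : ℂ) *
        (-(α + 1) * logPow α p (Complex.normSq t + ε) +
          logPowPred α p (Complex.normSq t + ε)) * φ t) = 0 := by
  have hg' : ContinuousOn
      (fun s : ℝ => (-(α + 1) * logPow α p s + logPowPred α p s) / (s : ℂ)) (Ioi 0) :=
    ((continuousOn_const.mul (continuousOn_logPow α p)).add (continuousOn_logPowPred α p)).div
      Complex.continuous_ofReal.continuousOn fun s hs => by exact_mod_cast (ne_of_gt hs)
  have key := integral_lineDeriv_radial_eq_zero (fun s => hasDerivAt_logPow α p) hg' hε hφ hφc c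
  obtain ⟨i1, e1⟩ := key 1
  obtain ⟨i2, e2⟩ := key Complex.I
  have h := integral_add i1 (i2.const_mul c)
  rw [integral_const_mul, e1, e2, mul_zero, add_zero] at h
  have h' := congrArg ((1 / 2 : ℂ) * ·) h
  simp only [mul_zero] at h'
  rw [← integral_const_mul] at h'
  rw [← h']
  congr 1
  ext t
  have hs : ((Complex.normSq t + ε : ℝ) : ℂ) ≠ 0 := by
    exact_mod_cast (add_pos_of_nonneg_of_pos (Complex.normSq_nonneg t) hε).ne'
  have hn : ((Complex.normSq t : ℝ) : ℂ) = wirtCoord c t * (t.re + c * t.im) := by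
    rw [Complex.normSq_apply, wirtCoord]
    push_cast
    linear_combination ((t.im : ℂ) ^ 2) * hc
  have hI : wirtCoord c Complex.I = -c := by simp [wirtCoord]
  have h1 : wirtCoord c 1 = 1 := by simp [wirtCoord]
  rw [hI, h1, Complex.ofReal_div, hn, wirt]
  simp only [Complex.one_re, Complex.one_im, Complex.I_re, Complex.I_im, mul_one, mul_zero,
    add_zero, zero_add]
  generalize logPow α p (Complex.normSq t + ε) = A
  generalize logPowPred α p (Complex.normSq t + ε) = B
  generalize ((Complex.normSq t + ε : ℝ) : ℂ) = s at *
  push_cast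
  field_simp
  linear_combination (s * A * φ t) * hc

end TestFunction

theorem exists_normSq_le_of_hasCompactSupport {φ : ℂ → ℂ} (hφc : HasCompactSupport φ) :
    ∃ R, ∀ t, φ t ≠ 0 → Complex.normSq t ≤ R := by
  obtain ⟨R, hR⟩ := hφc.isCompact.bddAbove_image Complex.continuous_normSq.continuousOn
  exact ⟨R, fun t ht => hR (mem_image_of_mem _ (subset_tsupport _ ht))⟩

/-- A uniform-in-`ε` integrable majorant for a radial profile with a mild singularity, multiplied
by a compactly supported function. -/
theorem norm_profile_mul_le {g : ℝ → ℂ} {C M β R : ℝ} (hC : 0 ≤ C) (hβ : 0 ≤ β)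
    (hg : ∀ s, 0 < s → s ≤ M → ‖g s‖ ≤ C * s ^ (-β)) (hM : R + 1 ≤ M) {ψ : ℂ → ℂ}
    (hψ : ∀ t, ψ t ≠ 0 → Complex.normSq t ≤ R) {ε : ℝ} (hε : 0 ≤ ε) (hε1 : ε ≤ 1) {t : ℂ}
    (ht : t ≠ 0) :
    ‖g (Complex.normSq t + ε) * ψ t‖ ≤ C * ‖Complex.normSq t ^ (-β) * ‖ψ t‖‖ := by
  by_cases h0 : ψ t = 0
  · simp [h0]
  have hpos : 0 < Complex.normSq t := Complex.normSq_pos.2 ht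
  have h1 := hg (Complex.normSq t + ε) (by linarith) (by linarith [hψ t h0])
  have h2 : (Complex.normSq t + ε) ^ (-β) ≤ Complex.normSq t ^ (-β) :=
    Real.rpow_le_rpow_of_nonpos hpos (by linarith) (by linarith)
  rw [norm_mul, norm_mul, norm_norm, Real.norm_of_nonneg (by positivity), ← mul_assoc]
  gcongr
  exact h1.trans (by gcongr)

theorem integrable_profile_mul {g : ℝ → ℂ} (hgc : ContinuousOn g (Ioi 0)) {β : ℝ} (hβ : 0 ≤ β)
    (hβ1 : β < 1)
    (hg : ∀ M, ∃ C, 0 ≤ C ∧ ∀ s, 0 < s → s ≤ M → ‖g s‖ ≤ C * s ^ (-β)) {ψ : ℂ → ℂ}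
    (hψ : Continuous ψ) (hψc : HasCompactSupport ψ) :
    Integrable fun t : ℂ => g (Complex.normSq t) * ψ t := by
  obtain ⟨R, hR⟩ := exists_normSq_le_of_hasCompactSupport hψc
  obtain ⟨C, hC, h⟩ := hg (R + 1)
  have hint := ((locallyIntegrable_normSq_rpow hβ1).integrable_smul_right_of_hasCompactSupport
    hψ.norm hψc.norm).norm.const_mul C
  have hmeas : AEStronglyMeasurable (fun t : ℂ => g (Complex.normSq t) * ψ t) := by
    have hc : ContinuousOn (fun t : ℂ => g (Complex.normSq t) * ψ t) {0}ᶜ :=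
      (hgc.comp Complex.continuous_normSq.continuousOn
        fun t ht => Complex.normSq_pos.2 ht).mul hψ.continuousOn
    have := hc.aestronglyMeasurable (μ := volume) (measurableSet_singleton (0 : ℂ)).compl
    rwa [restrict_compl_singleton] at this
  refine hint.mono' hmeas ?_
  filter_upwards [compl_mem_ae_iff.2 (measure_singleton (0 : ℂ))] with t ht
  simpa using norm_profile_mul_le hC hβ h le_rfl hR le_rfl zero_le_one ht

theorem integral_limit_eq_zero (α : ℂ) (hα₁ : -1 ≤ α.re) (hα₂ : α.re < 0) (p : ℕ) {c : ℂ}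
    (hc : c ^ 2 = -1) {φ : ℂ → ℂ} (hφ : ContDiff ℝ (⊤ : ℕ∞) φ) (hφc : HasCompactSupport φ) :
    ∫ t : ℂ, (logPow α p (Complex.normSq t) * (φ t + wirtCoord c t * wirt c φ t) +
      (-(α + 1) * logPow α p (Complex.normSq t) + logPowPred α p (Complex.normSq t)) * φ t)
      = 0 := by
  obtain ⟨β, hβ, hβ1⟩ : ∃ β, α.re + 1 < β ∧ β < 1 := exists_between (by linarith)
  have hβ0 : 0 ≤ β := by linarith
  have hψ : Continuous fun t => φ t + wirtCoord c t * wirt c φ t :=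
    hφ.continuous.add ((continuous_wirtCoord c).mul (continuous_wirt hφ c))
  have hψc : HasCompactSupport fun t => φ t + wirtCoord c t * wirt c φ t :=
    hφc.add (hasCompactSupport_wirt hφ hφc c).mul_left
  obtain ⟨R₁, hR₁⟩ := exists_normSq_le_of_hasCompactSupport hψc
  obtain ⟨R₂, hR₂⟩ := exists_normSq_le_of_hasCompactSupport hφc
  obtain ⟨C₁, hC₁, h₁⟩ := exists_norm_logPow_le α p hβ (max R₁ R₂ + 1)
  obtain ⟨C₂, hC₂, h₂⟩ := exists_norm_logPowPred_le α p hβ (max R₁ R₂ + 1)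
  have hloc := locallyIntegrable_normSq_rpow hβ1
  have iψ := (hloc.integrable_smul_right_of_hasCompactSupport hψ.norm hψc.norm).norm
  have iφ := (hloc.integrable_smul_right_of_hasCompactSupport hφ.continuous.norm hφc.norm).norm
  simp only [smul_eq_mul] at iψ iφ
  let ε : ℕ → ℝ := fun n => 1 / ((n : ℝ) + 1)
  have hε (n) : 0 < ε n := by positivity
  have hε1 (n) : ε n ≤ 1 := by
    simp only [ε]
    rw [div_le_one (by positivity)]
    linarith [n.cast_nonneg (α := ℝ)]
  have hεlim : Tendsto ε atTop (𝓝 0) := tendsto_one_div_add_atTop_nhds_zero_nat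
  have hlim := tendsto_integral_of_dominated_convergence (μ := volume)
    (F := fun n (t : ℂ) =>
      logPow α p (Complex.normSq t + ε n) * (φ t + wirtCoord c t * wirt c φ t) +
      ((Complex.normSq t / (Complex.normSq t + ε n) : ℝ) : ℂ) *
        (-(α + 1) * logPow α p (Complex.normSq t + ε n) +
          logPowPred α p (Complex.normSq t + ε n)) * φ t)
    (f := fun t : ℂ => logPow α p (Complex.normSq t) * (φ t + wirtCoord c t * wirt c φ t) +
      (-(α + 1) * logPow α p (Complex.normSq t) + logPowPred α p (Complex.normSq t)) * φ t)
    (fun t => C₁ * ‖Complex.normSq t ^ (-β) * ‖φ t + wirtCoord c t * wirt c φ t‖‖ +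
      (‖α + 1‖ * (C₁ * ‖Complex.normSq t ^ (-β) * ‖φ t‖‖) +
        C₂ * ‖Complex.normSq t ^ (-β) * ‖φ t‖‖))
    (fun n => ?_)
    ((iψ.const_mul C₁).add (((iφ.const_mul C₁).const_mul _).add (iφ.const_mul C₂)))
    (fun n => ?_) ?_
  · simp only [integral_regularized_eq_zero α p hc (hε _) hφ hφc] at hlim
    exact tendsto_nhds_unique hlim tendsto_const_nhds
  · have hA := continuous_comp_normSq_add (continuousOn_logPow α p) (hε n)
    have hB := continuous_comp_normSq_add (continuousOn_logPowPred α p) (hε n)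
    have hq : Continuous fun t : ℂ => Complex.normSq t / (Complex.normSq t + ε n) :=
      Complex.continuous_normSq.div (Complex.continuous_normSq.add continuous_const)
        fun t => (add_pos_of_nonneg_of_pos (Complex.normSq_nonneg t) (hε n)).ne'
    exact ((hA.mul hψ).add (((Complex.continuous_ofReal.comp hq).mul
      ((continuous_const.mul hA).add hB)).mul hφ.continuous)).aestronglyMeasurable
  · filter_upwards [compl_mem_ae_iff.2 (measure_singleton (0 : ℂ))] with t ht
    have b₁ := norm_profile_mul_le hC₁ hβ0 h₁ (add_le_add_left (le_max_left R₁ R₂) 1)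
      hR₁ (hε n).le (hε1 n) ht
    have b₂ := norm_profile_mul_le hC₁ hβ0 h₁ (add_le_add_left (le_max_right R₁ R₂) 1)
      hR₂ (hε n).le (hε1 n) ht
    have b₃ := norm_profile_mul_le hC₂ hβ0 h₂ (add_le_add_left (le_max_right R₁ R₂) 1)
      hR₂ (hε n).le (hε1 n) ht
    have hnn := Complex.normSq_nonneg t
    have hq : ‖((Complex.normSq t / (Complex.normSq t + ε n) : ℝ) : ℂ)‖ ≤ 1 := by
      have := hε n
      rw [Complex.norm_real, Real.norm_of_nonneg (by positivity)]
      exact div_le_one_of_le₀ (by linarith) (by positivity)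
    refine (norm_add_le _ _).trans (add_le_add b₁ ?_)
    rw [mul_assoc, norm_mul]
    refine (mul_le_of_le_one_left (norm_nonneg _) hq).trans ?_
    rw [add_mul, mul_assoc]
    refine (norm_add_le _ _).trans (add_le_add ?_ b₃)
    rw [norm_mul, norm_neg]
    gcongr
  · filter_upwards [compl_mem_ae_iff.2 (measure_singleton (0 : ℂ))] with t ht
    have hpos : 0 < Complex.normSq t := Complex.normSq_pos.2 ht
    have hs : Tendsto (fun n => Complex.normSq t + ε n) atTop (𝓝 (Complex.normSq t)) := by
      simpa using hεlim.const_add (Complex.normSq t)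
    have hA := ((continuousOn_logPow α p).continuousAt (Ioi_mem_nhds hpos)).tendsto.comp hs
    have hB := ((continuousOn_logPowPred α p).continuousAt (Ioi_mem_nhds hpos)).tendsto.comp hs
    have hq : Tendsto (fun n => ((Complex.normSq t / (Complex.normSq t + ε n) : ℝ) : ℂ)) atTop
        (𝓝 1) := by
      have := (tendsto_const_nhds (x := Complex.normSq t)).div hs hpos.ne'
      rw [div_self hpos.ne'] at this
      rw [← Complex.ofReal_one]
      exact (Complex.continuous_ofReal.tendsto 1).comp this
    have := (hA.mul_const (φ t + wirtCoord c t * wirt c φ t)).add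
      ((hq.mul ((hA.const_mul (-(α + 1))).add hB)).mul_const (φ t))
    rw [one_mul] at this
    exact this

theorem integral_uap_mul_eq (α : ℂ) (hα₁ : -1 ≤ α.re) (hα₂ : α.re < 0) (p : ℕ) {c : ℂ}
    (hc : c ^ 2 = -1) {φ : ℂ → ℂ} (hφ : ContDiff ℝ (⊤ : ℕ∞) φ) (hφc : HasCompactSupport φ) :
    ∫ t : ℂ, uap α p t * (α * φ t - wirtCoord c t * wirt c φ t) =
      ∫ t : ℂ, (if p = 0 then 0 else uap α (p - 1) t) * φ t := by
  obtain ⟨β, hβ, hβ1⟩ : ∃ β, α.re + 1 < β ∧ β < 1 := exists_between (by linarith)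
  have hβ0 : 0 ≤ β := by linarith
  have hne : ∀ᵐ t : ℂ, t ≠ 0 := compl_mem_ae_iff.2 (measure_singleton (0 : ℂ))
  have hl : ∫ t : ℂ, uap α p t * (α * φ t - wirtCoord c t * wirt c φ t) =
      ∫ t : ℂ, logPow α p (Complex.normSq t) * (α * φ t - wirtCoord c t * wirt c φ t) :=
    integral_congr_ae (hne.mono fun t ht => by simp only [uap_eq_logPow α p ht])
  have hr : ∫ t : ℂ, (if p = 0 then 0 else uap α (p - 1) t) * φ t =
      ∫ t : ℂ, logPowPred α p (Complex.normSq t) * φ t :=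
    integral_congr_ae (hne.mono fun t ht => by simp only [uap_eq_logPow α _ ht, logPowPred])
  have i1 := integrable_profile_mul (continuousOn_logPow α p) hβ0 hβ1
    (exists_norm_logPow_le α p hβ)
    ((continuous_const.mul hφ.continuous).sub
      ((continuous_wirtCoord c).mul (continuous_wirt hφ c)))
    ((hφc.mul_left (f := fun _ => α)).sub
      ((hasCompactSupport_wirt hφ hφc c).mul_left (f := wirtCoord c)))
  have i2 := integrable_profile_mul (continuousOn_logPowPred α p) hβ0 hβ1
    (exists_norm_logPowPred_le α p hβ) hφ.continuous hφc
  rw [hl, hr, eq_comm, ← sub_eq_zero]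
  refine (integral_sub i2 i1).symm.trans ?_
  rw [← integral_limit_eq_zero α hα₁ hα₂ p hc hφ hφc]
  congr 1
  ext t
  simp only [Pi.sub_apply, Pi.mul_apply]
  ring

/-- Distributional identity `(∂_t t + α) u_{α,p} = (∂_{t̄} t̄ + α) u_{α,p} = u_{α,p-1}`
(with `u_{α,-1} = 0`), tested against smooth compactly supported functions, for
`-1 ≤ Re α < 0`. -/
theorem uap_distributional_identity (α : ℂ) (hα₁ : -1 ≤ α.re) (hα₂ : α.re < 0) (p : ℕ)
    (φ : ℂ → ℂ) (hφ : ContDiff ℝ (⊤ : ℕ∞) φ) (hφc : HasCompactSupport φ) :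
    (∫ t : ℂ, uap α p t * (α * φ t - t * wirtD φ t)) =
        (∫ t : ℂ, (if p = 0 then 0 else uap α (p - 1) t) * φ t) ∧
      (∫ t : ℂ, uap α p t * (α * φ t - (starRingEnd ℂ) t * wirtDbar φ t)) =
        (∫ t : ℂ, (if p = 0 then 0 else uap α (p - 1) t) * φ t) := by
  constructor
  · rw [← integral_uap_mul_eq α hα₁ hα₂ p (c := -Complex.I) (by simp) hφ hφc]
    congr 1
    ext t
    have h : wirtCoord (-Complex.I) t = t := by
      conv_rhs => rw [← Complex.re_add_im t]
      rw [wirtCoord]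
      ring
    rw [h, wirt, wirtD, neg_mul, ← sub_eq_add_neg]
  · rw [← integral_uap_mul_eq α hα₁ hα₂ p (c := Complex.I) (by simp) hφ hφc]
    congr 1
    ext t
    have h : wirtCoord Complex.I t = (starRingEnd ℂ) t := by
      apply Complex.ext <;> simp [wirtCoord]
    rw [h, wirt, wirtDbar]
end

section
/- Let α ∈ ℂ with −1 ≤ Re(α) < 0 and p ∈ ℕ. Define the operator Q on smooth compactly supported functions φ : ℂ → ℂ by (Qφ)(t) = α·φ(t) − t·(∂_tφ)(t). Then for every smooth compactly supported φ one has ∫_ℂ u_{α,p}(t)·(Q^{p+1}φ)(t) dA(t) = 0, and the same holds with Q replaced by Q̄ defined by (Q̄φ)(t) = α·φ(t) − t̄·(∂_{t̄}φ)(t). (This is the distributional identity (∂_t t + α)^{p+1} u_{α,p} = (∂_{t̄} t̄ + α)^{p+1} u_{α,p} = 0.) -/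
open MeasureTheory

/-- The operator `Q = α - t ∂_t` on test functions (the formal adjoint of `∂_t t + α`). -/
noncomputable def Qop (α : ℂ) (φ : ℂ → ℂ) : ℂ → ℂ :=
  fun t => α * φ t - t * wirtD φ t

/-- The operator `Q̄ = α - t̄ ∂_{t̄}` on test functions (the formal adjoint of
`∂_{t̄} t̄ + α`). -/
noncomputable def Qbarop (α : ℂ) (φ : ℂ → ℂ) : ℂ → ℂ :=
  fun t => α * φ t - (starRingEnd ℂ) t * wirtDbar φ t

theorem abs_log_le_const_mul_rpow_neg {R s x : ℝ} (hs : 0 < s) (hx : 0 < x) (hxR : x ≤ R) :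
    |Real.log x| ≤ (R ^ (2 * s) + 1) / s * x ^ (-s) := by
  have hpos : 0 < x ^ (-s) := Real.rpow_pos_of_pos hx _
  have h1 : Real.log x ≤ x ^ s / s := Real.log_le_rpow_div hx.le hs
  have h2 : -Real.log x ≤ x ^ (-s) / s := by
    have h := Real.log_le_rpow_div (x := x⁻¹) (by positivity) hs
    rwa [Real.log_inv, Real.inv_rpow hx.le, ← Real.rpow_neg hx.le] at h
  have h3 : x ^ s ≤ R ^ (2 * s) * x ^ (-s) := by
    have h : x ^ s = x ^ (2 * s) * x ^ (-s) := by
      rw [← Real.rpow_add hx]; ring_nf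
    rw [h]
    gcongr
  have hR : 0 ≤ R ^ (2 * s) := Real.rpow_nonneg (hx.le.trans hxR) _
  have h4 : (R ^ (2 * s) + 1) / s * x ^ (-s)
      = (R ^ (2 * s) * x ^ (-s)) / s + x ^ (-s) / s := by ring
  rw [h4, abs_le]
  constructor
  · have : 0 ≤ R ^ (2 * s) * x ^ (-s) / s := by positivity
    linarith
  · have : x ^ s / s ≤ R ^ (2 * s) * x ^ (-s) / s := by gcongr
    have : 0 ≤ x ^ (-s) / s := by positivity
    linarith

theorem norm_uap (α : ℂ) (p : ℕ) {z : ℂ} (hz : z ≠ 0) :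
    ‖uap α p z‖ = ‖z‖ ^ (-2 * (α.re + 1)) * (2 * |Real.log ‖z‖|) ^ p / p.factorial := by
  have hz' : 0 < ‖z‖ := norm_pos_iff.2 hz
  rw [uap, if_neg hz, norm_div, norm_mul, norm_pow, Complex.norm_natCast, Complex.norm_real,
    Complex.norm_cpow_eq_rpow_re_of_pos (by positivity), Real.log_pow, Real.norm_eq_abs, abs_mul,
    ← Real.rpow_natCast ‖z‖ 2, ← Real.rpow_mul hz'.le]
  have h : ((2 : ℕ) : ℝ) * (-(α + 1)).re = -2 * (α.re + 1) := by simp; ring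
  rw [h]
  simp

theorem measurable_uap (α : ℂ) (p : ℕ) : Measurable (uap α p) := by
  unfold uap
  refine Measurable.ite (measurableSet_singleton 0) measurable_const ?_
  fun_prop

theorem integrableOn_uap_ball {α : ℂ} (hα : α.re < 0) (p : ℕ) (R : ℝ) :
    IntegrableOn (uap α p) (Metric.ball 0 R) := by
  rcases le_or_gt R 0 with hR | hR
  · simp [Metric.ball_eq_empty.2 hR]
  set s : ℝ := -α.re / (p + 1) with hs_def
  have hs : 0 < s := div_pos (by linarith) (by positivity)
  have hsp : s * p < -α.re := by
    have : s * (p + 1) = -α.re := by rw [hs_def]; field_simp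
    linarith
  set K : ℝ := (R ^ (2 * s) + 1) / s
  set C : ℝ := (2 * K) ^ p / p.factorial
  set e : ℝ := -2 * (α.re + 1) - s * p with he
  have key : Integrable (fun z : ℂ ↦ (Set.Ioo 0 R).indicator (fun x : ℝ ↦ C * x ^ e) ‖z‖) := by
    rw [integrable_fun_norm_addHaar (volume : Measure ℂ)
      (f := (Set.Ioo 0 R).indicator (fun x : ℝ ↦ C * x ^ e))]
    have h1 : IntegrableOn (fun x : ℝ ↦ C * x ^ (e + 1)) (Set.Ioo 0 R) :=
      ((intervalIntegral.integrableOn_Ioo_rpow_iff hR).2 (by rw [he]; linarith)).const_mul C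
    refine (((integrable_indicator_iff measurableSet_Ioo).2 h1).integrableOn).congr_fun
      (fun x hx ↦ ?_) measurableSet_Ioi
    by_cases hxR : x ∈ Set.Ioo 0 R
    · simp only [Set.indicator_of_mem hxR, Complex.finrank_real_complex]
      rw [Real.rpow_add_one hx.ne']
      simp
      ring
    · simp [Set.indicator_of_notMem hxR]
  refine Integrable.mono' key.integrableOn (measurable_uap α p).aestronglyMeasurable ?_
  filter_upwards [ae_restrict_mem Metric.isOpen_ball.measurableSet,
    ae_restrict_of_ae (Measure.ae_ne volume (0 : ℂ))] with z hzR hz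
  have hz' : 0 < ‖z‖ := norm_pos_iff.2 hz
  have hzR' : ‖z‖ < R := by simpa using hzR
  rw [Set.indicator_of_mem (show ‖z‖ ∈ Set.Ioo 0 R from ⟨hz', hzR'⟩), norm_uap α p hz]
  have h2 : (2 * |Real.log ‖z‖|) ^ p ≤ (2 * K) ^ p * ‖z‖ ^ (-(s * p)) := by
    calc (2 * |Real.log ‖z‖|) ^ p ≤ (2 * (K * ‖z‖ ^ (-s))) ^ p := by
          gcongr
          exact abs_log_le_const_mul_rpow_neg hs hz' hzR'.le
      _ = (2 * K) ^ p * ‖z‖ ^ (-(s * p)) := by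
          rw [← mul_assoc, mul_pow, ← Real.rpow_mul_natCast hz'.le, neg_mul]
  calc _ ≤ ‖z‖ ^ (-2 * (α.re + 1)) * ((2 * K) ^ p * ‖z‖ ^ (-(s * p))) / p.factorial := by
        gcongr
    _ = C * ‖z‖ ^ e := by
        rw [he, sub_eq_add_neg, Real.rpow_add hz']
        ring

theorem integrable_uap_mul {α : ℂ} (hα : α.re < 0) (p : ℕ) {ψ : ℂ → ℂ} (hψ : Continuous ψ)
    (hψc : HasCompactSupport ψ) : Integrable fun z ↦ uap α p z * ψ z := by
  obtain ⟨R, hR⟩ := hψc.isCompact.isBounded.subset_ball 0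
  obtain ⟨C, hC⟩ := hψc.exists_bound_of_continuous hψ
  have h : IntegrableOn (fun z ↦ uap α p z * ψ z) (Metric.ball 0 R) :=
    (integrableOn_uap_ball hα p R).mul_bdd hψ.aestronglyMeasurable (.of_forall hC)
  refine (integrableOn_iff_integrable_of_support_subset ?_).1 h
  exact (Function.support_mul_subset_right _ _).trans ((subset_tsupport ψ).trans hR)

/-- The derivative of `log ‖z‖²` in the direction `e`. -/
noncomputable def logDir (e z : ℂ) : ℝ := 2 * inner ℝ z e / ‖z‖ ^ 2

theorem hasLineDerivAt_uap (α : ℂ) (p : ℕ) {z : ℂ} (hz : z ≠ 0) (e : ℂ) :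
    HasLineDerivAt ℝ (uap α p)
      ((-(α + 1) * uap α p z + (if p = 0 then 0 else 1) * uap α (p - 1) z) * logDir e z) z e := by
  have hform (q : ℕ) {w : ℂ} (hw : w ≠ 0) : uap α q w =
      Complex.exp (-(α + 1) * (Real.log (‖w‖ ^ 2) : ℝ)) * (Real.log (‖w‖ ^ 2) : ℝ) ^ q
        / q.factorial := by
    have hw' : 0 < ‖w‖ := norm_pos_iff.2 hw
    rw [uap, if_neg hw, Complex.cpow_def_of_ne_zero (by simpa using hw),
      Complex.ofReal_log (by positivity), mul_comm (Complex.log _)]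
  have hlin : HasDerivAt (fun t : ℝ ↦ z + t • e) e 0 := by
    simpa using ((hasDerivAt_id (0 : ℝ)).smul_const e).const_add z
  have hlog : HasDerivAt (fun t : ℝ ↦ ((Real.log (‖z + t • e‖ ^ 2) : ℝ) : ℂ)) (logDir e z) 0 := by
    have h := (hlin.norm_sq.log (by simpa using hz)).ofReal_comp
    simpa [logDir] using h
  have hu := (((hlog.const_mul (-(α + 1))).cexp).mul (hlog.pow p)).div_const
    (p.factorial : ℂ)
  have hne : ∀ᶠ t : ℝ in nhds 0, z + t • e ≠ 0 :=
    hlin.continuousAt.eventually_ne (by simpa using hz)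
  refine (hu.congr_of_eventuallyEq (hne.mono fun t ht ↦ hform p ht)).congr_deriv ?_
  rw [hform p hz, hform (p - 1) hz]
  rcases p with _ | p
  · simp
    ring
  · have : ((p + 1 : ℂ)) ≠ 0 := by exact_mod_cast p.succ_ne_zero
    have : (p.factorial : ℂ) ≠ 0 := by exact_mod_cast p.factorial_ne_zero
    simp [Nat.factorial_succ]
    field_simp

theorem integral_eq_zero_of_hasLineDerivAt_one {f f' : ℂ → ℂ}
    (h : ∀ z ≠ 0, HasLineDerivAt ℝ f (f' z) z 1) (hf : HasCompactSupport f)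
    (hf' : Integrable f') : ∫ z, f' z = 0 := by
  have hmp := Complex.volume_preserving_equiv_real_prod.symm
  have hint : Integrable (fun q : ℝ × ℝ ↦ f' (Complex.measurableEquivRealProd.symm q))
      ((volume : Measure ℝ).prod volume) := by
    rw [← Measure.volume_eq_prod]
    exact (hmp.integrable_comp_emb Complex.measurableEquivRealProd.symm.measurableEmbedding).2 hf'
  rw [← hmp.integral_comp' f', Measure.volume_eq_prod, integral_prod_symm _ hint]
  refine integral_eq_zero_of_ae ?_
  filter_upwards [hint.prod_left_ae, Measure.ae_ne volume (0 : ℝ)] with y hy hy0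
  have hd (x : ℝ) : HasDerivAt (fun x : ℝ ↦ f ⟨x, y⟩) (f' ⟨x, y⟩) x := by
    have hz : (⟨x, y⟩ : ℂ) ≠ 0 := fun h0 ↦ hy0 (congrArg Complex.im h0)
    have h1 := h _ hz
    rw [HasLineDerivAt, ← sub_self x] at h1
    refine (h1.comp_sub_const x x).congr_of_eventuallyEq (.of_forall fun t ↦ ?_)
    simp only
    congr 1
    apply Complex.ext <;> simp
  have hcont : Continuous fun x : ℝ ↦ f ⟨x, y⟩ :=
    continuous_iff_continuousAt.2 fun x ↦ (hd x).continuousAt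
  have hsupp : HasCompactSupport fun x : ℝ ↦ f ⟨x, y⟩ := by
    have hemb : Topology.IsClosedEmbedding (fun x : ℝ ↦ (⟨x, y⟩ : ℂ)) := by
      refine Isometry.isClosedEmbedding (Isometry.of_dist_eq fun a b ↦ ?_)
      simp [Complex.dist_eq_re_im, Real.dist_eq, Real.sqrt_sq_eq_abs]
    exact hf.comp_isClosedEmbedding hemb
  exact integral_eq_zero_of_hasDerivAt_of_integrable hd hy
    (hcont.integrable_of_hasCompactSupport hsupp)

theorem integral_eq_zero_of_hasLineDerivAt_s3 {f f' : ℂ → ℂ} (c : Circle)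
    (h : ∀ z ≠ 0, HasLineDerivAt ℝ f (f' z) z c) (hf : HasCompactSupport f)
    (hf' : Integrable f') : ∫ z, f' z = 0 := by
  have hmp := (rotation c).measurePreserving
  have hme := (rotation c).toHomeomorph.measurableEmbedding
  rw [← hmp.integral_comp hme f']
  refine integral_eq_zero_of_hasLineDerivAt_one (f := f ∘ rotation c) (fun z hz ↦ ?_)
    (hf.comp_homeomorph (rotation c).toHomeomorph) ((hmp.integrable_comp_emb hme).2 hf')
  have h1 := h (rotation c z) (by simpa using hz)
  rw [HasLineDerivAt] at h1 ⊢
  refine h1.congr_of_eventuallyEq (.of_forall fun t ↦ ?_)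
  simp [mul_add, mul_comm]

theorem contDiff_lineDeriv {ψ : ℂ → ℂ} (hψ : ContDiff ℝ (⊤ : ℕ∞) ψ) (e : ℂ) :
    ContDiff ℝ (⊤ : ℕ∞) fun z ↦ lineDeriv ℝ ψ z e := by
  have h : (fun z ↦ lineDeriv ℝ ψ z e) = fun z ↦ fderiv ℝ ψ z e :=
    funext fun z ↦ (hψ.differentiable (by simp) z).lineDeriv_eq_fderiv
  rw [h]
  exact (hψ.fderiv_right (by simp)).clm_apply contDiff_const

theorem hasCompactSupport_lineDeriv_s3 {ψ : ℂ → ℂ} (hψ : ContDiff ℝ (⊤ : ℕ∞) ψ)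
    (hψc : HasCompactSupport ψ) (e : ℂ) : HasCompactSupport fun z ↦ lineDeriv ℝ ψ z e := by
  have h : (fun z ↦ lineDeriv ℝ ψ z e) = fun z ↦ fderiv ℝ ψ z e :=
    funext fun z ↦ (hψ.differentiable (by simp) z).lineDeriv_eq_fderiv
  rw [h]
  exact hψc.fderiv_apply ℝ e

theorem contDiff_Qop (α : ℂ) {ψ : ℂ → ℂ} (hψ : ContDiff ℝ (⊤ : ℕ∞) ψ) :
    ContDiff ℝ (⊤ : ℕ∞) (Qop α ψ) := by
  have h1 := contDiff_lineDeriv hψ 1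
  have h2 := contDiff_lineDeriv hψ Complex.I
  unfold Qop wirtD
  fun_prop

theorem hasCompactSupport_Qop (α : ℂ) {ψ : ℂ → ℂ} (hψ : ContDiff ℝ (⊤ : ℕ∞) ψ)
    (hψc : HasCompactSupport ψ) : HasCompactSupport (Qop α ψ) := by
  have h1 := hasCompactSupport_lineDeriv_s3 hψ hψc 1
  have h2 := hasCompactSupport_lineDeriv_s3 hψ hψc Complex.I
  exact (hψc.mul_left (f := fun _ ↦ α)).sub
    (((h1.sub (h2.mul_left (f := fun _ ↦ Complex.I))).mul_left (f := fun _ ↦ 1 / 2)).mul_left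
      (f := fun z ↦ z))

theorem norm_mul_logDir_le (e z : ℂ) : ‖z * logDir e z‖ ≤ 2 * ‖e‖ := by
  rcases eq_or_ne z 0 with rfl | hz
  · simp
  have hz' : 0 < ‖z‖ := norm_pos_iff.2 hz
  rw [norm_mul, Complex.norm_real, logDir, norm_div, norm_mul, norm_pow, norm_norm,
    mul_div_assoc', div_le_iff₀ (by positivity)]
  have := norm_inner_le_norm (𝕜 := ℝ) z e
  calc ‖z‖ * (‖(2 : ℝ)‖ * ‖inner ℝ z e‖) ≤ ‖z‖ * (2 * (‖z‖ * ‖e‖)) := by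
        rw [Real.norm_two]; gcongr
    _ = _ := by ring

theorem mul_logDir_sub (z : ℂ) (hz : z ≠ 0) :
    z * (logDir 1 z - Complex.I * logDir Complex.I z) = 2 := by
  have h : (‖z‖ : ℂ) ^ 2 = z * (starRingEnd ℂ) z := (Complex.mul_conj' z).symm
  have hc : (starRingEnd ℂ) z = z.re - Complex.I * z.im := by
    apply Complex.ext <;> simp
  have hn : (‖z‖ : ℂ) ≠ 0 := by simpa using hz
  simp only [logDir, Complex.inner]
  simp
  field_simp
  rw [h, hc]

/-- The derivative of `z * uap α p z * ψ z` in the direction `e`, away from `0`. -/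
noncomputable def uapFlux (α : ℂ) (p : ℕ) (ψ : ℂ → ℂ) (e z : ℂ) : ℂ :=
  e * (uap α p z * ψ z) + -(α + 1) * (uap α p z * ψ z * (z * logDir e z))
    + (if p = 0 then 0 else 1) * (uap α (p - 1) z * ψ z * (z * logDir e z))
    + uap α p z * (z * lineDeriv ℝ ψ z e)

theorem integrable_uapFlux {α : ℂ} (hα : α.re < 0) (p : ℕ) {ψ : ℂ → ℂ}
    (hψ : ContDiff ℝ (⊤ : ℕ∞) ψ) (hψc : HasCompactSupport ψ) (e : ℂ) :
    Integrable (uapFlux α p ψ e) := by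
  have hm : Measurable fun z : ℂ ↦ z * (logDir e z : ℂ) := by
    unfold logDir
    fun_prop
  have h (q : ℕ) : Integrable fun z ↦ uap α q z * ψ z * (z * logDir e z) :=
    (integrable_uap_mul hα q hψ.continuous hψc).mul_bdd hm.aestronglyMeasurable
      (.of_forall (norm_mul_logDir_le e))
  exact ((((integrable_uap_mul hα p hψ.continuous hψc).const_mul _).add
    ((h p).const_mul _)).add ((h (p - 1)).const_mul _)).add
    (integrable_uap_mul hα p (continuous_id.mul (contDiff_lineDeriv hψ e).continuous)
      ((hasCompactSupport_lineDeriv_s3 hψ hψc e).mul_left (f := id)))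

theorem integral_uapFlux {α : ℂ} (hα : α.re < 0) (p : ℕ) {ψ : ℂ → ℂ}
    (hψ : ContDiff ℝ (⊤ : ℕ∞) ψ) (hψc : HasCompactSupport ψ) (c : Circle) :
    ∫ z, uapFlux α p ψ c z = 0 := by
  refine integral_eq_zero_of_hasLineDerivAt_s3 (f := fun z ↦ z * uap α p z * ψ z) c (fun z hz ↦ ?_)
    hψc.mul_left (integrable_uapFlux hα p hψ hψc c)
  have hlin : HasDerivAt (fun t : ℝ ↦ z + t • (c : ℂ)) c 0 := by
    simpa using ((hasDerivAt_id (0 : ℝ)).smul_const (c : ℂ)).const_add z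
  have hψd := (hψ.differentiable (by simp) z).lineDifferentiableAt (v := (c : ℂ)).hasLineDerivAt
  have h := (hlin.mul (hasLineDerivAt_uap α p hz c)).mul hψd
  refine HasDerivAt.congr_deriv h ?_
  simp only [uapFlux, Pi.mul_apply, zero_smul, add_zero]
  ring

theorem integral_uap_mul_Qop {α : ℂ} (hα : α.re < 0) (p : ℕ) {ψ : ℂ → ℂ}
    (hψ : ContDiff ℝ (⊤ : ℕ∞) ψ) (hψc : HasCompactSupport ψ) :
    ∫ z, uap α p z * Qop α ψ z =
      (if p = 0 then 0 else 1) * ∫ z, uap α (p - 1) z * ψ z := by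
  have h1 : ∫ z, uapFlux α p ψ 1 z = 0 := by
    simpa using integral_uapFlux hα p hψ hψc 1
  have hI : ∫ z, uapFlux α p ψ Complex.I z = 0 :=
    integral_uapFlux hα p hψ hψc ⟨Complex.I, by simp [Submonoid.unitSphere]⟩
  have hi1 := integrable_uapFlux hα p hψ hψc 1
  have hiI := integrable_uapFlux hα p hψ hψc Complex.I
  have hae : (fun z ↦ uap α p z * Qop α ψ z) =ᵐ[volume] fun z ↦
      (if p = 0 then 0 else 1) * (uap α (p - 1) z * ψ z)
        - (1 / 2) * (uapFlux α p ψ 1 z - Complex.I * uapFlux α p ψ Complex.I z) := by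
    filter_upwards [Measure.ae_ne volume (0 : ℂ)] with z hz
    have hk := mul_logDir_sub z hz
    simp only [uapFlux, Qop, wirtD]
    linear_combination (1 / 2) * ((if p = 0 then 0 else 1) * (uap α (p - 1) z * ψ z)
      - (α + 1) * (uap α p z * ψ z)) * hk - (1 / 2) * (uap α p z * ψ z) * Complex.I_sq
  have hi : Integrable fun z ↦
      uapFlux α p ψ 1 z - Complex.I * uapFlux α p ψ Complex.I z := hi1.sub (hiI.const_mul _)
  rw [integral_congr_ae hae, integral_sub
    ((integrable_uap_mul hα (p - 1) hψ.continuous hψc).const_mul _)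
    (hi.const_mul _), integral_const_mul, integral_const_mul,
    integral_sub hi1 (hiI.const_mul _), integral_const_mul, h1, hI]
  simp

theorem integral_uap_mul_iterate_Qop {α : ℂ} (hα : α.re < 0) (p : ℕ) {φ : ℂ → ℂ}
    (hφ : ContDiff ℝ (⊤ : ℕ∞) φ) (hφc : HasCompactSupport φ) :
    ∫ z, uap α p z * ((Qop α)^[p + 1] φ) z = 0 := by
  have hiter (n : ℕ) : ContDiff ℝ (⊤ : ℕ∞) ((Qop α)^[n] φ) ∧
      HasCompactSupport ((Qop α)^[n] φ) := by
    induction n with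
    | zero => exact ⟨hφ, hφc⟩
    | succ n ih =>
      rw [Function.iterate_succ_apply']
      exact ⟨contDiff_Qop α ih.1, hasCompactSupport_Qop α ih.1 ih.2⟩
  induction p with
  | zero => simpa using integral_uap_mul_Qop hα 0 hφ hφc
  | succ p ih =>
    rw [Function.iterate_succ_apply', integral_uap_mul_Qop hα _ (hiter _).1 (hiter _).2]
    simpa using ih

theorem Qbarop_comp_conj (α : ℂ) (φ : ℂ → ℂ) :
    Qbarop α φ ∘ starRingEnd ℂ = Qop α (φ ∘ starRingEnd ℂ) := by
  have h (z v : ℂ) : lineDeriv ℝ (φ ∘ starRingEnd ℂ) z v =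
      lineDeriv ℝ φ ((starRingEnd ℂ) z) ((starRingEnd ℂ) v) := by
    simp [lineDeriv]
  funext z
  simp only [Function.comp_apply, Qbarop, Qop, wirtD, wirtDbar, h]
  simp [lineDeriv_neg]

theorem iterate_Qbarop_comp_conj (α : ℂ) (φ : ℂ → ℂ) (n : ℕ) :
    (Qbarop α)^[n] φ ∘ starRingEnd ℂ = (Qop α)^[n] (φ ∘ starRingEnd ℂ) := by
  induction n with
  | zero => rfl
  | succ n ih =>
    rw [Function.iterate_succ_apply', Function.iterate_succ_apply', Qbarop_comp_conj, ih]

theorem uap_conj (α : ℂ) (p : ℕ) (z : ℂ) : uap α p ((starRingEnd ℂ) z) = uap α p z := by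
  simp [uap]

/-- Distributional identity `(∂_t t + α)^{p+1} u_{α,p} = (∂_{t̄} t̄ + α)^{p+1} u_{α,p} = 0`
for `-1 ≤ Re α < 0`, tested against smooth compactly supported functions. -/
theorem uap_killed_by_power (α : ℂ) (hα₁ : -1 ≤ α.re) (hα₂ : α.re < 0) (p : ℕ)
    (φ : ℂ → ℂ) (hφ : ContDiff ℝ (⊤ : ℕ∞) φ) (hφc : HasCompactSupport φ) :
    (∫ t : ℂ, uap α p t * ((Qop α)^[p + 1] φ) t) = 0 ∧
      (∫ t : ℂ, uap α p t * ((Qbarop α)^[p + 1] φ) t) = 0 := by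
  refine ⟨integral_uap_mul_iterate_Qop hα₂ p hφ hφc, ?_⟩
  rw [← Complex.conjLIE.measurePreserving.integral_comp
    Complex.conjLIE.toHomeomorph.measurableEmbedding]
  have h := integral_uap_mul_iterate_Qop hα₂ p (φ := φ ∘ starRingEnd ℂ)
    (hφ.comp Complex.conjCLE.contDiff) (hφc.comp_homeomorph Complex.conjLIE.toHomeomorph)
  rw [← iterate_Qbarop_comp_conj] at h
  simpa only [Function.comp_apply, Complex.conjLIE_apply, uap_conj] using h
end
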